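/- Let G be a finite simple graph, k ≥ 0, and let P be a (3k+2)-string based at a vertex v of G. Let w be the vertex of P adjacent to v, and set U = N_G(v) \ {w}. Then the inclusion I(G \ U) ↪ I(G) is a homotopy equivalence. -/

import Mathlib

/-! ## Simplicial complexes, realizations, and homotopy-theoretic notions -/

/-- The independence complex of a simple graph, as an abstract simplicial complex:
the collection of finite independent sets of vertices. -/
def indepCx {V : Type} (G : SimpleGraph V) : Set (Finset V) :=
  {s | ∀ u ∈ s, ∀ v ∈ s, ¬ G.Adj u v}

/-- The matching complex of a simple graph: the collection of finite sets of edges,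
no two of which share an endpoint. -/
def matchCx {V : Type} (G : SimpleGraph V) : Set (Finset (Sym2 V)) :=
  {s | (↑s : Set (Sym2 V)) ⊆ G.edgeSet ∧
    ∀ e ∈ s, ∀ e' ∈ s, e ≠ e' → ∀ x : V, x ∈ e → x ∉ e'}

/-- The geometric realization of an abstract simplicial complex `K` on vertex set `V`:
the space of convex-combination weight functions supported on a simplex of `K`. -/
def geom {V : Type} (K : Set (Finset V)) : Type :=
  {f : V → ℝ // (∃ s ∈ K, ∀ v, f v ≠ 0 → v ∈ s) ∧ (∀ v, 0 ≤ f v) ∧ ∑ᶠ v, f v = 1}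

noncomputable instance geom.topInst {V : Type} (K : Set (Finset V)) :
    TopologicalSpace (geom K) :=
  instTopologicalSpaceSubtype

/-- A continuous map is a homotopy equivalence. -/
def IsHtpyEquiv {X Y : Type} [TopologicalSpace X] [TopologicalSpace Y] (f : C(X, Y)) : Prop :=
  ∃ g : C(Y, X), (g.comp f).Homotopic (ContinuousMap.id X) ∧
    (f.comp g).Homotopic (ContinuousMap.id Y)

/-- Any singleton vertex set is independent. -/
lemma singleton_mem_indepCx {V : Type} (G : SimpleGraph V) (v : V) :
    ({v} : Finset V) ∈ indepCx G := by
  intro u hu w hw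
  simp only [Finset.mem_singleton] at hu hw
  subst hu; subst hw
  exact G.irrefl

/-- The point of a geometric realization corresponding to a vertex. -/
noncomputable def geomPt {V : Type} [DecidableEq V] {K : Set (Finset V)} (v : V)
    (h : ({v} : Finset V) ∈ K) : geom K := by
  refine ⟨fun w => if w = v then 1 else 0, ⟨{v}, h, fun w hw => ?_⟩, fun w => ?_, ?_⟩
  · by_cases hwv : w = v
    · simp [hwv]
    · simp [hwv] at hw
  · by_cases hwv : w = v <;> simp [hwv]
  · rw [finsum_eq_single _ v (fun x hx => if_neg hx)]
    simp

/-- The `k`-dimensional sphere. -/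
def Sph (k : ℕ) : Type := Metric.sphere (0 : EuclideanSpace ℝ (Fin (k+1))) 1

noncomputable instance Sph.topInst (k : ℕ) : TopologicalSpace (Sph k) := by
  unfold Sph; infer_instance

/-- A pointed topological space. -/
structure Ptd where
  carrier : Type
  [topInst : TopologicalSpace carrier]
  pt : carrier

attribute [instance] Ptd.topInst

/-- The one-point pointed space. -/
def Ptd.point : Ptd := { carrier := PUnit, pt := PUnit.unit }

/-- The `k`-sphere as a pointed space. -/
noncomputable def Ptd.sphere (k : ℕ) : Ptd where
  carrier := Sph k
  pt := ⟨EuclideanSpace.single 0 1, by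
    simp [mem_sphere_iff_norm, EuclideanSpace.norm_single]⟩

/-- The wedge sum of two pointed spaces. -/
def Ptd.wedge (X Y : Ptd) : Ptd where
  carrier := Quot (fun p q : X.carrier ⊕ Y.carrier => p = q ∨
    (p = Sum.inl X.pt ∧ q = Sum.inr Y.pt) ∨ (p = Sum.inr Y.pt ∧ q = Sum.inl X.pt))
  pt := Quot.mk _ (Sum.inl X.pt)

/-- The reduced suspension of a pointed space: in `X × [0,1]`, collapse
`X × {0} ∪ X × {1} ∪ {pt} × [0,1]` to a point. -/
def Ptd.susp (X : Ptd) : Ptd where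
  carrier := Quot (fun p q : X.carrier × unitInterval => p = q ∨
    ((p.2 = 0 ∨ p.2 = 1 ∨ p.1 = X.pt) ∧ (q.2 = 0 ∨ q.2 = 1 ∨ q.1 = X.pt)))
  pt := Quot.mk _ (X.pt, 0)

/-- Iterated reduced suspension `Σ^k`. -/
def Ptd.suspIter (k : ℕ) (X : Ptd) : Ptd := Ptd.susp^[k] X

/-- The wedge of `k` copies of a pointed space (the empty wedge being a point). -/
def Ptd.wedgeIter : ℕ → Ptd → Ptd
  | 0, _ => Ptd.point
  | k+1, X => (Ptd.wedgeIter k X).wedge X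

/-- A finite wedge of spheres of prescribed dimensions (the empty wedge being a point). -/
noncomputable def wedgeOfSpheres : List ℕ → Ptd
  | [] => Ptd.point
  | d :: ds => (Ptd.sphere d).wedge (wedgeOfSpheres ds)

/-- A space is `k`-connected (`k : ℤ`): it is nonempty whenever `k ≥ -1`, and every
continuous map from a sphere of dimension `≤ k` into it is null-homotopic. -/
def IsConn (X : Type) [TopologicalSpace X] (k : ℤ) : Prop :=
  (-1 ≤ k → Nonempty X) ∧
    ∀ i : ℕ, (i : ℤ) ≤ k → ∀ f : C(Sph i, X), ∃ x : X,
      f.Homotopic (ContinuousMap.const _ x)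

/-! ## Inclusions of independence complexes of induced subgraphs -/

/-- Extension by zero of a function defined on a subset of `V`. -/
noncomputable def extendZero {V : Type} {S : Set V} (f : ↥S → ℝ) : V → ℝ :=
  Function.extend Subtype.val f 0

lemma extendZero_mem {V : Type} {S : Set V} (f : ↥S → ℝ) (x : ↥S) :
    extendZero f ↑x = f x :=
  Subtype.val_injective.extend_apply f 0 x

lemma extendZero_not_mem {V : Type} {S : Set V} (f : ↥S → ℝ) {v : V} (h : v ∉ S) :
    extendZero f v = 0 :=
  Function.extend_apply' f (0 : V → ℝ) v (fun ⟨x, hx⟩ => h (hx ▸ x.2))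

lemma finsum_extendZero {V : Type} {S : Set V} (f : ↥S → ℝ) :
    ∑ᶠ v, extendZero f v = ∑ᶠ x : ↥S, f x := by
  rw [show (fun x : ↥S => f x) = fun x : ↥S => extendZero f ↑x from
      funext fun x => (extendZero_mem f x).symm,
    finsum_set_coe_eq_finsum_mem, ← finsum_mem_univ (f := extendZero f),
    finsum_mem_inter_support_eq' _ Set.univ S]
  intro x hx
  simp only [Set.mem_univ, true_iff]
  exact by_contra fun h => hx (extendZero_not_mem f h)

/-- An independent set of an induced subgraph is independent in the ambient graph. -/
lemma indep_image {V : Type} [DecidableEq V] (G : SimpleGraph V) (S : Set V)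
    {s : Finset ↥S} (hs : s ∈ indepCx (G.induce S)) :
    s.image Subtype.val ∈ indepCx G := by
  intro u hu v hv
  simp only [Finset.mem_image] at hu hv
  obtain ⟨u', hu', rfl⟩ := hu
  obtain ⟨v', hv', rfl⟩ := hv
  exact hs u' hu' v' hv'

/-- The inclusion of the realization of the independence complex of an induced
subgraph into that of the ambient graph (extension of weight functions by zero). -/
noncomputable def inclMap {V : Type} [DecidableEq V] (G : SimpleGraph V) (S : Set V) :
    C(geom (indepCx (G.induce S)), geom (indepCx G)) where
  toFun f := ⟨extendZero f.1, by
      obtain ⟨s, hsK, hsupp⟩ := f.2.1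
      refine ⟨s.image Subtype.val, indep_image G S hsK, fun v hv => ?_⟩
      by_cases h : v ∈ S
      · rw [show v = ↑(⟨v, h⟩ : ↥S) from rfl, extendZero_mem] at hv
        exact Finset.mem_image.2 ⟨⟨v, h⟩, hsupp _ hv, rfl⟩
      · exact absurd (extendZero_not_mem f.1 h) hv,
    fun v => by
      by_cases h : v ∈ S
      · rw [show v = ↑(⟨v, h⟩ : ↥S) from rfl, extendZero_mem]; exact f.2.2.1 _
      · rw [extendZero_not_mem f.1 h],
    by rw [finsum_extendZero]; exact f.2.2.2⟩
  continuous_toFun := by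
    apply Continuous.subtype_mk
    apply continuous_pi
    intro v
    by_cases h : v ∈ S
    · have : (fun f : geom (indepCx (G.induce S)) => extendZero f.1 v) =
        fun f : geom (indepCx (G.induce S)) => f.1 ⟨v, h⟩ :=
        funext fun f => extendZero_mem f.1 ⟨v, h⟩
      rw [this]
      exact (continuous_apply _).comp continuous_subtype_val
    · have : (fun f : geom (indepCx (G.induce S)) => extendZero f.1 v) =
        fun _ => (0 : ℝ) := funext fun f => extendZero_not_mem f.1 h
      rw [this]
      exact continuous_const

/-! ## The graphs `G_{n,t}` and `H_{n,t}` (line graphs of polygonal line tilings) -/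

/-- Ambient vertex names for the graphs `G_{n,t}`: `a i`, `b i j`, `c i j`. -/
inductive GV : Type
  | a : ℕ → GV
  | b : ℕ → ℕ → GV
  | c : ℕ → ℕ → GV
deriving DecidableEq

/-- The base adjacency rules of `G_{n,t}` on the ambient vertex names (the parameter
`t` is handled by restricting to the appropriate vertex set). -/
def gRel (n : ℕ) : GV → GV → Prop
  | .a i, .b i' j => i' = i + 1 ∧ (j = 1 ∨ j = n - 1)
  | .a i, .c i' j => i' = i ∧ (j = 1 ∨ j = n - 1)
  | .b i j, .b i' j' => (i' = i ∧ j' = j + 1) ∨ (i' = i + 1 ∧ j = n - 1 ∧ j' = 1)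
  | .c i j, .c i' j' => (i' = i ∧ j' = j + 1) ∨ (i' = i + 1 ∧ j = n - 1 ∧ j' = 1)
  | _, _ => False

/-- The graph on all ambient vertex names with the adjacency rules of the `G_{n,t}`. -/
def gFull (n : ℕ) : SimpleGraph GV := SimpleGraph.fromRel (gRel n)

/-- The vertex set of `G_{n,t}`:
`{a_0, …, a_t} ∪ {b_{i,j}, c_{i,j} : 1 ≤ i ≤ t, 1 ≤ j ≤ n-1}`. -/
def GVset (n t : ℕ) : Set GV :=
  {v | match v with
    | .a i => i ≤ t
    | .b i j => 1 ≤ i ∧ i ≤ t ∧ 1 ≤ j ∧ j ≤ n - 1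
    | .c i j => 1 ≤ i ∧ i ≤ t ∧ 1 ≤ j ∧ j ≤ n - 1}

/-- The graph `G_{n,t}`, the line graph of the polygonal line tiling of `t` `2n`-gons. -/
def lineG (n t : ℕ) : SimpleGraph (GVset n t) := (gFull n).induce (GVset n t)

/-- The vertex set of `H_{n,t}`: that of `G_{n,t}` plus `b_{t+1,1}` and `c_{t+1,1}`. -/
def HVset (n t : ℕ) : Set GV := GVset n t ∪ {GV.b (t+1) 1, GV.c (t+1) 1}

/-- The graph `H_{n,t}`, the induced subgraph of `G_{n,t+1}` on
`V(G_{n,t}) ∪ {b_{t+1,1}, c_{t+1,1}}`. -/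
def lineH (n t : ℕ) : SimpleGraph (HVset n t) := (gFull n).induce (HVset n t)

lemma a0_mem_GVset (n t : ℕ) : GV.a 0 ∈ GVset n t := by simp [GVset]

lemma a0_mem_HVset (n t : ℕ) : GV.a 0 ∈ HVset n t := Or.inl (a0_mem_GVset n t)

/-- The realization of `I(G_{n,t})`, pointed at the vertex `a_0`. -/
noncomputable def IG (n t : ℕ) : Ptd where
  carrier := geom (indepCx (lineG n t))
  pt := geomPt ⟨GV.a 0, a0_mem_GVset n t⟩ (singleton_mem_indepCx _ _)

/-- The realization of `I(H_{n,t})`, pointed at the vertex `a_0`. -/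
noncomputable def IH (n t : ℕ) : Ptd where
  carrier := geom (indepCx (lineH n t))
  pt := geomPt ⟨GV.a 0, a0_mem_HVset n t⟩ (singleton_mem_indepCx _ _)

/-- The vertex set of `X_t = G_{n,t} ∖ a_{t-1}`. -/
def XVset (n t : ℕ) : Set GV := GVset n t \ {GV.a (t-1)}

/-- The graph `X_t = G_{n,t} ∖ a_{t-1}`. -/
def lineX (n t : ℕ) : SimpleGraph (XVset n t) := (gFull n).induce (XVset n t)

/-- The vertex set of `Y_t = X_t ∖ a_{t-2}`. -/
def YVset (n t : ℕ) : Set GV := XVset n t \ {GV.a (t-2)}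

/-- The graph `Y_t = X_t ∖ a_{t-2}`. -/
def lineY (n t : ℕ) : SimpleGraph (YVset n t) := (gFull n).induce (YVset n t)

lemma a0_mem_XVset {n t : ℕ} (ht : 2 ≤ t) : GV.a 0 ∈ XVset n t := by
  refine ⟨a0_mem_GVset n t, fun h => ?_⟩
  rw [Set.mem_singleton_iff] at h
  injection h with h'
  omega

lemma a0_mem_YVset {n t : ℕ} (ht : 3 ≤ t) : GV.a 0 ∈ YVset n t := by
  refine ⟨a0_mem_XVset (by omega), fun h => ?_⟩
  rw [Set.mem_singleton_iff] at h
  injection h with h'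
  omega

/-- The realization of `I(X_t)`, pointed at the vertex `a_0` (for `t ≥ 2`). -/
noncomputable def IX (n t : ℕ) (ht : 2 ≤ t) : Ptd where
  carrier := geom (indepCx (lineX n t))
  pt := geomPt ⟨GV.a 0, a0_mem_XVset ht⟩ (singleton_mem_indepCx _ _)

/-- The realization of `I(Y_t)`, pointed at the vertex `a_0` (for `t ≥ 3`). -/
noncomputable def IY (n t : ℕ) (ht : 3 ≤ t) : Ptd where
  carrier := geom (indepCx (lineY n t))
  pt := geomPt ⟨GV.a 0, a0_mem_YVset ht⟩ (singleton_mem_indepCx _ _)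

/-! ## The polygonal line tilings `P_{n,t}` themselves -/

/-- Ambient vertex names for the tiling `P_{n,t}`: `u i`/`v i` are the endpoints of the
`i`-th shared (vertical) edge, and `p i j` / `q i j` are the intermediate vertices of
the top/bottom boundary path of the `i`-th polygon. -/
inductive PV : Type
  | u : ℕ → PV
  | v : ℕ → PV
  | p : ℕ → ℕ → PV
  | q : ℕ → ℕ → PV
deriving DecidableEq

/-- The base adjacency rules of the tiling `P_{n,t}` on the ambient vertex names. -/
def pRel (n : ℕ) : PV → PV → Prop
  | .u i, .v i' => i' = i
  | .u i, .u i' => i' = i + 1 ∧ n = 2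
  | .v i, .v i' => i' = i + 1 ∧ n = 2
  | .u i, .p i' j => (i' = i + 1 ∧ j = 1) ∨ (i' = i ∧ j = n - 2)
  | .v i, .q i' j => (i' = i + 1 ∧ j = 1) ∨ (i' = i ∧ j = n - 2)
  | .p i j, .p i' j' => i' = i ∧ j' = j + 1
  | .q i j, .q i' j' => i' = i ∧ j' = j + 1
  | _, _ => False

/-- The graph on all ambient tiling vertex names. -/
def pFull (n : ℕ) : SimpleGraph PV := SimpleGraph.fromRel (pRel n)

/-- The vertex set of `P_{n,t}`. -/
def PVset (n t : ℕ) : Set PV :=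
  {w | match w with
    | .u i => i ≤ t
    | .v i => i ≤ t
    | .p i j => 1 ≤ i ∧ i ≤ t ∧ 1 ≤ j ∧ j ≤ n - 2
    | .q i j => 1 ≤ i ∧ i ≤ t ∧ 1 ≤ j ∧ j ≤ n - 2}

/-- The polygonal line tiling `P_{n,t}` of `t` `2n`-gons. -/
def polyP (n t : ℕ) : SimpleGraph (PVset n t) := (pFull n).induce (PVset n t)

/-! ## Homotopy equivalences -/

namespace IsHtpyEquiv

variable {X Y Z : Type} [TopologicalSpace X] [TopologicalSpace Y] [TopologicalSpace Z]

lemma comp {f : C(Y, Z)} {g : C(X, Y)} (hf : IsHtpyEquiv f) (hg : IsHtpyEquiv g) :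
    IsHtpyEquiv (f.comp g) := by
  obtain ⟨f', hf₁, hf₂⟩ := hf
  obtain ⟨g', hg₁, hg₂⟩ := hg
  refine ⟨g'.comp f', ?_, ?_⟩
  · have h : ((g'.comp (f'.comp f)).comp g).Homotopic ((g'.comp (.id Y)).comp g) :=
      ((ContinuousMap.Homotopic.refl g').comp hf₁).comp (.refl g)
    exact h.trans hg₁
  · have h : ((f.comp (g.comp g')).comp f').Homotopic ((f.comp (.id Y)).comp f') :=
      ((ContinuousMap.Homotopic.refl f).comp hg₂).comp (.refl f')
    exact h.trans hf₂

lemma of_homotopic {f g : C(X, Y)} (hf : IsHtpyEquiv f) (h : f.Homotopic g) :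
    IsHtpyEquiv g := by
  obtain ⟨f', hf₁, hf₂⟩ := hf
  exact ⟨f', ((ContinuousMap.Homotopic.refl f').comp h.symm).trans hf₁,
    (h.symm.comp (.refl f')).trans hf₂⟩

lemma of_comp_right {f : C(Y, Z)} {g : C(X, Y)} (hg : IsHtpyEquiv g)
    (hfg : IsHtpyEquiv (f.comp g)) : IsHtpyEquiv f := by
  obtain ⟨g', hg₁, hg₂⟩ := hg
  have h : IsHtpyEquiv ((f.comp g).comp g') := hfg.comp ⟨g, hg₂, hg₁⟩
  exact h.of_homotopic ((ContinuousMap.Homotopic.refl f).comp hg₂)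

end IsHtpyEquiv

/-! ## Maps between geometric realizations -/

/-- The inclusion of the realization of a subcomplex. -/
def geomMono {V : Type} {K L : Set (Finset V)} (h : K ⊆ L) : C(geom K, geom L) where
  toFun f := ⟨f.1, f.2.1.imp fun _ hs => ⟨h hs.1, hs.2⟩, f.2.2⟩
  continuous_toFun := Continuous.subtype_mk continuous_subtype_val _

/-- Two maps into the realization of a complex which carry each point into a common
simplex are homotopic, by a straight-line homotopy. -/
lemma homotopic_of_common_simplex {V : Type} [Fintype V] {X : Type} [TopologicalSpace X]
    {K : Set (Finset V)} (f g : C(X, geom K))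
    (h : ∀ x, ∃ s ∈ K, (∀ v, (f x).1 v ≠ 0 → v ∈ s) ∧ (∀ v, (g x).1 v ≠ 0 → v ∈ s)) :
    f.Homotopic g := by
  have hf : Continuous fun x => (f x).1 := continuous_subtype_val.comp f.continuous
  have hg : Continuous fun x => (g x).1 := continuous_subtype_val.comp g.continuous
  refine ⟨{
    toFun := fun p => ⟨fun v => (1 - (p.1 : ℝ)) * (f p.2).1 v + (p.1 : ℝ) * (g p.2).1 v,
      ?_, ?_, ?_⟩
    continuous_toFun := ?_
    map_zero_left := ?_
    map_one_left := ?_ }⟩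
  · obtain ⟨s, hs, hfs, hgs⟩ := h p.2
    refine ⟨s, hs, fun v hv => ?_⟩
    by_contra hvs
    have h₁ : (f p.2).1 v = 0 := by_contra fun h => hvs (hfs v h)
    have h₂ : (g p.2).1 v = 0 := by_contra fun h => hvs (hgs v h)
    simp [h₁, h₂] at hv
  · exact fun v => add_nonneg
      (mul_nonneg (sub_nonneg.2 p.1.2.2) ((f p.2).2.2.1 v))
      (mul_nonneg p.1.2.1 ((g p.2).2.2.1 v))
  · have h₁ := (f p.2).2.2.2
    have h₂ := (g p.2).2.2.2
    rw [finsum_eq_sum_of_fintype] at h₁ h₂ ⊢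
    rw [Finset.sum_add_distrib, ← Finset.mul_sum, ← Finset.mul_sum, h₁, h₂]
    ring
  · refine Continuous.subtype_mk (continuous_pi fun v => ?_) _
    have h₁ : Continuous fun p : unitInterval × X => (f p.2).1 v :=
      (continuous_apply v).comp (hf.comp continuous_snd)
    have h₂ : Continuous fun p : unitInterval × X => (g p.2).1 v :=
      (continuous_apply v).comp (hg.comp continuous_snd)
    have h₃ : Continuous fun p : unitInterval × X => (p.1 : ℝ) :=
      continuous_subtype_val.comp continuous_fst
    exact ((continuous_const.sub h₃).mul h₁).add (h₃.mul h₂)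
  · exact fun x => Subtype.ext (funext fun v => by simp)
  · exact fun x => Subtype.ext (funext fun v => by simp)

/-! ## Independence complexes of induced subgraphs, on the ambient vertex set -/

/-- The independent sets of a graph contained in `A`. -/
def indepOn {V : Type} (G : SimpleGraph V) (A : Set V) : Set (Finset V) :=
  {s | s ∈ indepCx G ∧ (s : Set V) ⊆ A}

lemma indepOn_mono {V : Type} (G : SimpleGraph V) {A B : Set V} (h : A ⊆ B) :
    indepOn G A ⊆ indepOn G B :=
  fun _ hs => ⟨hs.1, hs.2.trans h⟩

lemma geom_indepOn_eq_zero {V : Type} {G : SimpleGraph V} {A : Set V}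
    (f : geom (indepOn G A)) {v : V} (hv : v ∉ A) : f.1 v = 0 := by
  obtain ⟨s, hs, hfs⟩ := f.2.1
  exact by_contra fun h => hv (hs.2 (hfs v h))

lemma extendZero_geom_indepOn {V : Type} {G : SimpleGraph V} {S : Set V}
    (f : geom (indepOn G S)) : extendZero (fun v : S => f.1 v) = f.1 := by
  funext v
  by_cases hv : v ∈ S
  · exact extendZero_mem (fun v : S => f.1 v) ⟨v, hv⟩
  · rw [extendZero_not_mem _ hv, geom_indepOn_eq_zero f hv]

open Classical in
/-- Move all the weight outside of `A` to the vertex `x`. -/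
noncomputable def pushWeight {V : Type} [Fintype V] (A : Set V) (x : V) (f : V → ℝ) : V → ℝ :=
  fun z => if z ∈ A then f z + (if z = x then ∑ y with y ∉ A, f y else 0) else 0

lemma continuous_pushWeight {V : Type} [Fintype V] (A : Set V) (x : V) :
    Continuous (pushWeight A x) := by
  refine continuous_pi fun z => ?_
  unfold pushWeight
  split_ifs <;> fun_prop

lemma pushWeight_nonneg {V : Type} [Fintype V] (A : Set V) (x : V) {f : V → ℝ}
    (hf : ∀ v, 0 ≤ f v) (z : V) : 0 ≤ pushWeight A x f z := by
  unfold pushWeight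
  split_ifs
  · exact add_nonneg (hf z) (Finset.sum_nonneg fun y _ => hf y)
  · simpa using hf z
  · exact le_rfl

lemma sum_pushWeight {V : Type} [Fintype V] {A : Set V} {x : V} (hx : x ∈ A) (f : V → ℝ) :
    ∑ z, pushWeight A x f z = ∑ z, f z := by
  classical
  unfold pushWeight
  rw [← Finset.sum_filter, Finset.sum_add_distrib, Finset.sum_ite_eq',
    if_pos (by simpa using hx)]
  exact Finset.sum_filter_add_sum_filter_not _ _ _

lemma pushWeight_eq_self {V : Type} [Fintype V] {A : Set V} (x : V) {f : V → ℝ}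
    (hf : ∀ y ∉ A, f y = 0) : pushWeight A x f = f := by
  classical
  have h : ∑ y with y ∉ A, f y = 0 :=
    Finset.sum_eq_zero fun y hy => hf y (by simpa using hy)
  funext z
  by_cases hz : z ∈ A
  · simp [pushWeight, hz, h]
  · simp [pushWeight, hz, hf z hz]

/-- If every neighbor of `x` is a neighbor of every vertex of `B \ A`, then the weight on
`B \ A` can be moved to `x` without leaving the closed star of any point. -/
lemma pushWeight_common_simplex {V : Type} [Fintype V] {G : SimpleGraph V}
    {A B : Set V} (hAB : A ⊆ B) {x : V} (hx : x ∈ A)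
    (h : ∀ y ∈ B, y ∉ A → ∀ z ∈ B, G.Adj x z → G.Adj y z) (f : geom (indepOn G B)) :
    ∃ s ∈ indepOn G B, (∀ v, f.1 v ≠ 0 → v ∈ s) ∧
      (∀ v, pushWeight A x f.1 v ≠ 0 → v ∈ s) := by
  classical
  obtain ⟨s, hs, hfs⟩ := f.2.1
  by_cases hf : ∀ y ∉ A, f.1 y = 0
  · exact ⟨s, hs, hfs, by rwa [pushWeight_eq_self x hf]⟩
  · push Not at hf
    obtain ⟨y, hyA, hy⟩ := hf
    have hys := hfs y hy
    have hxs : ∀ z ∈ s, ¬ G.Adj x z := fun z hz hxz =>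
      hs.1 y hys z hz (h y (hs.2 hys) hyA z (hs.2 hz) hxz)
    refine ⟨insert x s, ⟨?_, ?_⟩, fun v hv => Finset.mem_insert_of_mem (hfs v hv), ?_⟩
    · intro a ha b hb
      rw [Finset.mem_insert] at ha hb
      rcases ha with rfl | ha <;> rcases hb with rfl | hb
      · exact G.irrefl
      · exact hxs b hb
      · exact fun hab => hxs a ha hab.symm
      · exact hs.1 a ha b hb
    · rw [Finset.coe_insert]
      exact Set.insert_subset (hAB hx) hs.2
    · intro v hv
      rw [Finset.mem_insert]
      by_contra! hvs
      refine hv ?_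
      have : f.1 v = 0 := by_contra fun h => hvs.2 (hfs v h)
      simp [pushWeight, this, hvs.1]

/-- The fold lemma: if every neighbor of `x` is a neighbor of every vertex of `B \ A`, then
deleting the vertices of `B \ A` does not change the homotopy type of the independence
complex. -/
lemma isHtpyEquiv_geomMono_of_fold {V : Type} [Fintype V] (G : SimpleGraph V)
    {A B : Set V} (hAB : A ⊆ B) {x : V} (hx : x ∈ A)
    (h : ∀ y ∈ B, y ∉ A → ∀ z ∈ B, G.Adj x z → G.Adj y z) :
    IsHtpyEquiv (geomMono (indepOn_mono G hAB)) := by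
  classical
  let r : C(geom (indepOn G B), geom (indepOn G A)) :=
    { toFun := fun f => ⟨pushWeight A x f.1, by
          obtain ⟨s, hs, -, hs'⟩ := pushWeight_common_simplex hAB hx h f
          refine ⟨s.filter (· ∈ A), ⟨fun a ha b hb => ?_, fun a ha => ?_⟩, fun v hv => ?_⟩
          · exact hs.1 a (Finset.mem_of_mem_filter a ha) b (Finset.mem_of_mem_filter b hb)
          · exact (Finset.mem_filter.1 ha).2
          · refine Finset.mem_filter.2 ⟨hs' v hv, by_contra fun hvA => hv ?_⟩
            simp [pushWeight, hvA],
        pushWeight_nonneg A x f.2.2.1, by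
          rw [finsum_eq_sum_of_fintype, sum_pushWeight hx, ← finsum_eq_sum_of_fintype]
          exact f.2.2.2⟩
      continuous_toFun :=
        ((continuous_pushWeight A x).comp continuous_subtype_val).subtype_mk _ }
  refine ⟨r, ?_, ?_⟩
  · have : r.comp (geomMono (indepOn_mono G hAB)) = .id _ :=
      ContinuousMap.ext fun f => Subtype.ext
        (pushWeight_eq_self x fun y hy => geom_indepOn_eq_zero f hy)
    rw [this]
  · refine homotopic_of_common_simplex _ _ fun f => ?_
    obtain ⟨s, hs, h₁, h₂⟩ := pushWeight_common_simplex hAB hx h f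
    exact ⟨s, hs, h₂, h₁⟩

lemma isHtpyEquiv_geomMono_of_eq {V : Type} {K L : Set (Finset V)} (h : K = L) :
    IsHtpyEquiv (geomMono h.subset) := by
  subst h
  exact ⟨.id _, .refl _, .refl _⟩

/-- Restriction of weight functions from the ambient vertex set to `S`. -/
def restrictGeom {V : Type} (G : SimpleGraph V) (S : Set V) :
    C(geom (indepOn G S), geom (indepCx (G.induce S))) where
  toFun f := ⟨fun v => f.1 v, by
      classical
      obtain ⟨s, hs, hfs⟩ := f.2.1
      refine ⟨s.subtype (· ∈ S), fun a ha b hb => ?_, fun v hv => ?_⟩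
      · exact hs.1 a (Finset.mem_subtype.1 ha) b (Finset.mem_subtype.1 hb)
      · exact Finset.mem_subtype.2 (hfs v hv),
    fun v => f.2.2.1 v, by
      rw [← finsum_extendZero, extendZero_geom_indepOn]
      exact f.2.2.2⟩
  continuous_toFun := by
    refine Continuous.subtype_mk (continuous_pi fun v => ?_) _
    exact (continuous_apply (v : V)).comp continuous_subtype_val

/-- The inclusion of an induced subgraph is an equivalence on independence complexes as soon
as it is one after identifying both complexes with complexes on the ambient vertex set. -/
lemma isHtpyEquiv_inclMap {V : Type} [DecidableEq V] (G : SimpleGraph V) (S : Set V)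
    (h : IsHtpyEquiv (geomMono (indepOn_mono G S.subset_univ))) :
    IsHtpyEquiv (inclMap G S) := by
  have huniv : indepOn G Set.univ = indepCx G := by simp [indepOn]
  let e : C(geom (indepCx (G.induce S)), geom (indepOn G S)) :=
    { toFun := fun f => ⟨(inclMap G S f).1, by
          obtain ⟨s, hs, hfs⟩ := (inclMap G S f).2.1
          classical
          refine ⟨s.filter (· ∈ S), ⟨fun a ha b hb => ?_, fun a ha => ?_⟩, fun v hv => ?_⟩
          · exact hs a (Finset.mem_of_mem_filter a ha) b (Finset.mem_of_mem_filter b hb)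
          · exact (Finset.mem_filter.1 ha).2
          · exact Finset.mem_filter.2
              ⟨hfs v hv, by_contra fun hvS => hv (extendZero_not_mem f.1 hvS)⟩,
        (inclMap G S f).2.2⟩
      continuous_toFun :=
        (continuous_subtype_val.comp (inclMap G S).continuous).subtype_mk _ }
  have hr : IsHtpyEquiv (restrictGeom G S) := by
    refine ⟨e, ?_, ?_⟩
    · have : e.comp (restrictGeom G S) = .id _ :=
        ContinuousMap.ext fun f => Subtype.ext (extendZero_geom_indepOn f)
      rw [this]
    · have : (restrictGeom G S).comp e = .id _ :=
        ContinuousMap.ext fun f => Subtype.ext (funext fun v => extendZero_mem f.1 v)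
      rw [this]
  refine hr.of_comp_right ?_
  have : (inclMap G S).comp (restrictGeom G S) =
      (geomMono huniv.subset).comp (geomMono (indepOn_mono G S.subset_univ)) :=
    ContinuousMap.ext fun f => Subtype.ext (extendZero_geom_indepOn f)
  rw [this]
  exact (isHtpyEquiv_geomMono_of_eq huniv).comp h

/-! ## Strings -/

/-- Deleting from an induced path of length `3k+2` with no outside neighbors, except at its
start, the vertices of index at least `3m` and congruent to `2` modulo `3` does not change
the homotopy type of the independence complex. -/
lemma isHtpyEquiv_geomMono_diff_string {V : Type} [Fintype V] (G : SimpleGraph V) (k : ℕ)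
    (path : Fin (3 * k + 2) → V) (hinj : Function.Injective path)
    (hadj : ∀ i j : Fin (3 * k + 2), G.Adj (path i) (path j) ↔
      (i.val + 1 = j.val ∨ j.val + 1 = i.val))
    (hstring : ∀ i : Fin (3 * k + 2), i.val ≠ 0 →
      ∀ w : V, w ∉ Set.range path → ¬ G.Adj (path i) w)
    (B : Set V) (hB : ∀ i, path i ∈ B) (m : ℕ) (hm : m ≤ k) :
    IsHtpyEquiv (geomMono (indepOn_mono G
      (Set.sdiff_subset : B \ path '' {i | i.val % 3 = 2 ∧ 3 * m ≤ i.val} ⊆ B))) := by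
  induction hm using Nat.decreasingInduction with
  | self =>
    have : path '' {i | i.val % 3 = 2 ∧ 3 * k ≤ i.val} = ∅ := by
      rw [Set.image_eq_empty, Set.eq_empty_iff_forall_notMem]
      intro i hi
      have := i.2
      simp only [Set.mem_ofPred_eq] at hi
      omega
    exact isHtpyEquiv_geomMono_of_eq (by rw [this, Set.sdiff_empty])
  | of_succ m hm ih =>
    have hsub : B \ path '' {i | i.val % 3 = 2 ∧ 3 * m ≤ i.val} ⊆
        B \ path '' {i | i.val % 3 = 2 ∧ 3 * (m + 1) ≤ i.val} := by
      refine Set.sdiff_subset_sdiff_right (Set.image_mono fun i hi => ⟨hi.1, ?_⟩)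
      have := hi.2
      omega
    refine ih.comp (isHtpyEquiv_geomMono_of_fold G hsub
      (x := path ⟨3 * m + 4, by omega⟩) ⟨hB _, ?_⟩ ?_)
    · rintro ⟨i, hi, hi'⟩
      have := congrArg Fin.val (hinj hi')
      have := hi.1
      simp only at *
      omega
    · rintro y ⟨hyB, hy⟩ hy' z ⟨-, hz⟩ hxz
      obtain ⟨i, hi, rfl⟩ : y ∈ path '' {i | i.val % 3 = 2 ∧ 3 * m ≤ i.val} :=
        by_contra fun h => hy' ⟨hyB, h⟩
      have hi₂ : ¬ 3 * (m + 1) ≤ i.val := fun h => hy ⟨i, ⟨hi.1, h⟩, rfl⟩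
      obtain ⟨j, rfl⟩ : z ∈ Set.range path :=
        by_contra fun h => hstring ⟨3 * m + 4, by omega⟩ (by simp) z h hxz
      have hj : ¬ (j.val % 3 = 2 ∧ 3 * (m + 1) ≤ j.val) := fun h => hz ⟨j, h, rfl⟩
      rw [hadj] at hxz ⊢
      simp only [Set.mem_ofPred_eq] at *
      omega

/-- Let `G` be a finite simple graph, `k ≥ 0`, and `P` a `(3k+2)`-string
based at `v` (an induced path `path 0 = v, path 1 = w, …` all of whose vertices other
than `v` have no neighbors outside the string). With `U = N_G(v) ∖ {w}`, the inclusion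
`I(G ∖ U) ↪ I(G)` is a homotopy equivalence. -/
theorem stmt_11 {V : Type} [Fintype V] [DecidableEq V] (G : SimpleGraph V) (k : ℕ)
    (v : V) (path : Fin (3*k+2) → V) (hinj : Function.Injective path)
    (hv : path ⟨0, by omega⟩ = v)
    (hadj : ∀ i j : Fin (3*k+2), G.Adj (path i) (path j) ↔
      (i.val + 1 = j.val ∨ j.val + 1 = i.val))
    (hstring : ∀ i : Fin (3*k+2), i ≠ ⟨0, by omega⟩ →
      ∀ w : V, w ∉ Set.range path → ¬ G.Adj (path i) w) :
    IsHtpyEquiv (inclMap G ((G.neighborSet v \ {path ⟨1, by omega⟩})ᶜ)) := by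
  subst hv
  apply isHtpyEquiv_inclMap
  set S : Set V := (G.neighborSet (path ⟨0, by omega⟩) \ {path ⟨1, by omega⟩})ᶜ with hS
  have hpath : ∀ i, path i ∈ S := by
    rintro i ⟨hi, hi'⟩
    rw [SimpleGraph.mem_neighborSet, hadj] at hi
    refine hi' (congrArg path (Fin.ext ?_))
    simp only at hi ⊢
    omega
  have hdiff := isHtpyEquiv_geomMono_diff_string G k path hinj hadj
    fun i hi => hstring i (mt (congrArg Fin.val) hi)
  refine (hdiff S hpath 0 k.zero_le).of_comp_right ?_
  refine (hdiff Set.univ (fun _ => Set.mem_univ _) 0 k.zero_le).comp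
    (isHtpyEquiv_geomMono_of_fold G (Set.sdiff_subset_sdiff_left S.subset_univ)
      (x := path ⟨1, by omega⟩) ⟨hpath _, ?_⟩ ?_)
  · rintro ⟨i, hi, hi'⟩
    have := congrArg Fin.val (hinj hi')
    have := hi.1
    simp only at *
    omega
  · rintro y ⟨-, hy⟩ hy' z ⟨-, hz⟩ hxz
    have hyS : y ∉ S := fun h => hy' ⟨h, hy⟩
    obtain ⟨j, rfl⟩ : z ∈ Set.range path :=
      by_contra fun h => hstring ⟨1, by omega⟩ (by simp) z h hxz
    have hj : ¬ (j.val % 3 = 2 ∧ 3 * 0 ≤ j.val) := fun h => hz ⟨j, h, rfl⟩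
    rw [hadj] at hxz
    obtain rfl : j = ⟨0, by omega⟩ := Fin.ext (by simp only at *; omega)
    rw [hS, Set.notMem_compl_iff] at hyS
    exact hyS.1.symm
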